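/- arXiv:1711.03681 — 5 statements merged into one kernel-verified Lean document; each statement's English description precedes it below -/
import Mathlib

section
/- Let G be a closed subgroup of O(N), φ : G → {1,−1} a continuous homomorphism, 1 < p < N and p* := Np/(N−p). For a G-invariant nonempty open set Θ ⊆ ℝ^N define S^φ(Θ) := inf { ∫_Θ |∇w|^p / (∫_Θ |w|^{p*})^{p/p*} : w a smooth compactly supported φ-equivariant function on Θ, w not identically zero } (infimum taken in [0,∞], with inf ∅ = ∞). If Ω is a G-invariant nonempty open subset of ℝ^N containing at least one G-fixed point, then S^φ(Ω) = S^φ(ℝ^N). -/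
open MeasureTheory
open scoped RealInnerProductSpace ENNReal

noncomputable section

/-- `ℝ^N` with the Euclidean norm. -/
abbrev EucSp (N : ℕ) : Type := EuclideanSpace ℝ (Fin N)

/-- The orthogonal group `O(N)`. -/
abbrev ONgrp (N : ℕ) : Type := Matrix.orthogonalGroup (Fin N) ℝ

/-- Action of an orthogonal matrix on `ℝ^N`. -/
def oact {N : ℕ} (g : ONgrp N) (x : EucSp N) : EucSp N :=
  Matrix.toEuclideanLin (g : Matrix (Fin N) (Fin N) ℝ) x

/-- The critical Sobolev exponent `p* = Np/(N-p)`. -/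
def pStar (N : ℕ) (p : ℝ) : ℝ := (N : ℝ) * p / ((N : ℝ) - p)

/-- The equivariant Sobolev quotient infimum
`S^φ(Θ) = inf { ∫_Θ |∇w|^p / (∫_Θ |w|^{p*})^{p/p*} }`, the infimum (in `[0,∞]`,
with `inf ∅ = ∞`) being taken over all smooth compactly supported `φ`-equivariant
functions on `Θ` which are not identically zero. -/
def eqvSobolevInf {N : ℕ} (G : Subgroup (ONgrp N)) (φ : G →* ℝ) (p : ℝ)
    (Θ : Set (EucSp N)) : ℝ≥0∞ :=
  ⨅ (w : EucSp N → ℝ) (_ : ContDiff ℝ (⊤ : ℕ∞) w) (_ : HasCompactSupport w)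
    (_ : tsupport w ⊆ Θ)
    (_ : ∀ (g : G) (x : EucSp N), w (oact (g : ONgrp N) x) = φ g * w x) (_ : w ≠ 0),
    ENNReal.ofReal ((∫ x, ‖gradient w x‖ ^ p) /
      (∫ x, |w x| ^ pStar N p) ^ (p / pStar N p))


lemma norm_gradient_scaled {N : ℕ} (w : EucSp N → ℝ) (c : ℝ) (hc : 0 < c)
    (x₀ x : EucSp N) :
    ‖gradient (fun y => w (c • (y - x₀))) x‖ = c * ‖gradient w (c • (x - x₀))‖ := by
  have h1 : fderiv ℝ (fun y => w (c • (y - x₀))) x = c • fderiv ℝ w (c • (x - x₀)) := by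
    have := fderiv_comp_sub (𝕜 := ℝ) (f := fun y => w (c • y)) (x := x) x₀
    rw [this]
    exact fderiv_comp_smul (f := w) (x := x - x₀) c
  simp only [gradient, LinearIsometryEquiv.norm_map]
  rw [h1, norm_smul, Real.norm_of_nonneg hc.le]

lemma integral_scaled {N : ℕ} (f : EucSp N → ℝ) (c : ℝ) (hc : 0 < c) (x₀ : EucSp N) :
    ∫ x, f (c • (x - x₀)) = (c ^ (N : ℝ))⁻¹ * ∫ x, f x := by
  rw [integral_sub_right_eq_self (μ := volume) (fun x => f (c • x)) x₀,
    Measure.integral_comp_smul]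
  have : 0 < (c ^ N)⁻¹ := by positivity
  simp [abs_of_pos hc]

lemma quotient_scaled {N : ℕ} (w : EucSp N → ℝ) (p : ℝ) (hp1 : 1 < p) (hpN : p < (N : ℝ))
    (c : ℝ) (hc : 0 < c) (x₀ : EucSp N) :
    (∫ x, ‖gradient (fun y => w (c • (y - x₀))) x‖ ^ p) /
      (∫ x, |w (c • (x - x₀))| ^ pStar N p) ^ (p / pStar N p) =
    (∫ x, ‖gradient w x‖ ^ p) / (∫ x, |w x| ^ pStar N p) ^ (p / pStar N p) := by
  have hN : (0 : ℝ) < N := by linarith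
  have e : p / pStar N p = (N - p) / N := by
    unfold pStar
    have : (N : ℝ) - p ≠ 0 := by linarith
    have : p ≠ 0 := by linarith
    field_simp
  have hA : (∫ x, ‖gradient (fun y => w (c • (y - x₀))) x‖ ^ p) =
      c ^ p * ((c ^ (N : ℝ))⁻¹ * ∫ x, ‖gradient w x‖ ^ p) := by
    rw [← integral_scaled (fun x => ‖gradient w x‖ ^ p) c hc x₀, ← integral_const_mul]
    congr 1
    ext x
    rw [norm_gradient_scaled w c hc, Real.mul_rpow hc.le (norm_nonneg _)]
  rw [hA, integral_scaled (fun x => |w x| ^ pStar N p) c hc x₀, e,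
    Real.mul_rpow (by positivity) (integral_nonneg fun x => by positivity)]
  have h2 : ((c ^ (N : ℝ))⁻¹) ^ (((N : ℝ) - p) / N) = c ^ p * (c ^ (N : ℝ))⁻¹ := by
    rw [← Real.rpow_neg hc.le, ← Real.rpow_mul hc.le, ← Real.rpow_add hc]
    congr 1
    field_simp
    ring
  rw [h2, ← mul_assoc, mul_div_mul_left _ _ (by positivity)]

/-- If `Ω` is a `G`-invariant nonempty open subset of `ℝ^N` containing a
`G`-fixed point, then `S^φ(Ω) = S^φ(ℝ^N)`. -/
theorem eqvSobolevInf_eq_of_fixedPoint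
    (N : ℕ) (G : Subgroup (ONgrp N)) (hGclosed : IsClosed (G : Set (ONgrp N)))
    (φ : G →* ℝ) (hφcont : Continuous φ) (hφval : ∀ g : G, φ g = 1 ∨ φ g = -1)
    (p : ℝ) (hp1 : 1 < p) (hpN : p < (N : ℝ))
    (Ω : Set (EucSp N)) (hΩopen : IsOpen Ω) (hΩne : Ω.Nonempty)
    (hΩinv : ∀ g ∈ G, ∀ x ∈ Ω, oact g x ∈ Ω)
    (hfix : ∃ x₀ ∈ Ω, ∀ g ∈ G, oact g x₀ = x₀) :
    eqvSobolevInf G φ p Ω = eqvSobolevInf G φ p (Set.univ : Set (EucSp N)) := by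
  obtain ⟨x₀, hx₀, hfx⟩ := hfix
  apply le_antisymm
  · unfold eqvSobolevInf
    refine le_iInf fun w => le_iInf fun hw => le_iInf fun hcs => le_iInf fun _ =>
      le_iInf fun heq => le_iInf fun hne => ?_
    obtain ⟨ε, hε, hball⟩ := Metric.isOpen_iff.1 hΩopen x₀ hx₀
    obtain ⟨R, hR, hsub⟩ := hcs.isCompact.isBounded.subset_ball_lt 0 (0 : EucSp N)
    set c : ℝ := R / ε with hcdef
    have hc : 0 < c := by positivity
    let v : EucSp N → ℝ := fun y => w (c • (y - x₀))
    let h : EucSp N ≃ₜ EucSp N :=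
      (Homeomorph.subRight x₀).trans (Homeomorph.smulOfNeZero c hc.ne')
    have hvh : v = w ∘ h := rfl
    have hts : tsupport v ⊆ h ⁻¹' tsupport w :=
      tsupport_comp_subset_preimage w h.continuous
    have h1 : ContDiff ℝ (⊤ : ℕ∞) v := by
      apply hw.comp
      fun_prop
    have h2 : HasCompactSupport v := hcs.comp_homeomorph h
    have h3 : tsupport v ⊆ Ω := by
      intro x hx
      apply hball
      have hx' : c • (x - x₀) ∈ Metric.ball (0 : EucSp N) R := hsub (hts hx)
      rw [mem_ball_zero_iff, norm_smul, Real.norm_of_nonneg hc.le, hcdef,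
        div_mul_eq_mul_div, div_lt_iff₀ hε] at hx'
      rw [mem_ball_iff_norm]
      exact lt_of_mul_lt_mul_left hx' hR.le
    have h4 : ∀ (g : G) (x : EucSp N), v (oact (g : ONgrp N) x) = φ g * v x := by
      intro g x
      show w _ = φ g * w _
      rw [← heq g]
      congr 1
      have := hfx g g.2
      conv_lhs => rw [← this]
      simp only [oact, map_smul, map_sub]
    have h5 : v ≠ 0 := by
      intro hv
      apply hne
      ext y
      have := congrFun hv (h.symm y)
      rw [hvh] at this
      simpa using this
    exact iInf_le_of_le v <| iInf_le_of_le h1 <| iInf_le_of_le h2 <| iInf_le_of_le h3 <|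
      iInf_le_of_le h4 <| iInf_le_of_le h5
        (congrArg ENNReal.ofReal (quotient_scaled w p hp1 hpN c hc x₀)).le
  · unfold eqvSobolevInf
    refine le_iInf fun w => le_iInf fun hw => le_iInf fun hcs => le_iInf fun _ =>
      le_iInf fun heq => le_iInf fun hne => ?_
    exact iInf_le_of_le w <| iInf_le_of_le hw <| iInf_le_of_le hcs <|
      iInf_le_of_le (Set.subset_univ _) <| iInf_le_of_le heq <| iInf_le_of_le hne le_rfl
end
end

section
/- Let G be a closed subgroup of O(N) such that for every x ∈ ℝ^N either Gx = {x} or Gx is infinite. Then for every pair of sequences (ε_k) in (0,∞) and (x_k) in ℝ^N there exist a sequence (ξ_k) in ℝ^N and a constant C_0 > 0 such that, after passing to a subsequence, dist(Gx_k, ξ_k) ≤ C_0 ε_k for all k, and one of the following holds: (a) every ξ_k is a G-fixed point; or (b) for each m ∈ ℕ there exist g_1, …, g_m ∈ G such that for all i ≠ j one has ε_k^{−1} |g_i ξ_k − g_j ξ_k| → ∞ as k → ∞. -/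
open MeasureTheory Filter Topology
open scoped RealInnerProductSpace

noncomputable section

/-- The `G`-orbit of a point `x ∈ ℝ^N`. -/
def orbitSet {N : ℕ} (G : Subgroup (ONgrp N)) (x : EucSp N) : Set (EucSp N) :=
  {y | ∃ g ∈ G, oact g x = y}

/-- The subspace of `G`-fixed points. -/
def fixSub {N : ℕ} (G : Subgroup (ONgrp N)) : Submodule ℝ (EucSp N) where
  carrier := {x | ∀ g ∈ G, oact g x = x}
  zero_mem' := by intro g _; simp [oact]
  add_mem' := by
    intro a b ha hb g hg
    have h1 := ha g hg
    have h2 := hb g hg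
    unfold oact at *
    rw [map_add, h1, h2]
  smul_mem' := by
    intro c a ha g hg
    have h1 := ha g hg
    unfold oact at *
    rw [map_smul, h1]


/-- If `G` is a closed subgroup of `O(N)` all of whose orbits are either
singletons or infinite, then for all sequences `(ε_k)` in `(0,∞)` and `(x_k)` in `ℝ^N`
there are, after passing to a subsequence, points `ξ_k` with `dist(Gx_k, ξ_k) ≤ C₀ ε_k`,
such that either every `ξ_k` is a `G`-fixed point, or for each `m` there are
`g_1, …, g_m ∈ G` with `ε_k⁻¹|g_i ξ_k − g_j ξ_k| → ∞` for `i ≠ j`. -/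
theorem orbit_dichotomy_along_subsequence
    (N : ℕ) (G : Subgroup (ONgrp N)) (hGclosed : IsClosed (G : Set (ONgrp N)))
    (hS1 : ∀ x : EucSp N, orbitSet G x = {x} ∨ (orbitSet G x).Infinite)
    (ε : ℕ → ℝ) (hε : ∀ k, 0 < ε k) (x : ℕ → EucSp N) :
    ∃ σ : ℕ → ℕ, StrictMono σ ∧
      ∃ (ξ : ℕ → EucSp N) (C₀ : ℝ), 0 < C₀ ∧
        (∀ k, Metric.infDist (ξ k) (orbitSet G (x (σ k))) ≤ C₀ * ε (σ k)) ∧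
        ((∀ k, ∀ g ∈ G, oact g (ξ k) = ξ k) ∨
          (∀ m : ℕ, ∃ g : Fin m → G, ∀ i j : Fin m, i ≠ j →
            Tendsto
              (fun k => (ε (σ k))⁻¹ *
                ‖oact (g i : ONgrp N) (ξ k) - oact (g j : ONgrp N) (ξ k)‖)
              atTop atTop)) := by
  set V := fixSub G with hV
  set w : ℕ → EucSp N := fun k => x k - V.starProjection (x k) with hw
  have hwmem : ∀ k, w k ∈ Vᗮ := fun k => V.sub_starProjection_mem_orthogonal (x k)
  have hfix : ∀ k, ∀ g ∈ G, oact g (V.starProjection (x k)) = V.starProjection (x k) := by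
    intro k
    have : V.starProjection (x k) ∈ V := V.starProjection_apply_mem (x k)
    exact this
  have hself : ∀ y : EucSp N, y ∈ orbitSet G y := fun y => ⟨1, G.one_mem, by simp [oact]⟩
  by_cases hA : ∃ C : ℝ, ∃ᶠ k in atTop, ‖w k‖ ≤ C * ε k
  · obtain ⟨C, hC⟩ := hA
    obtain ⟨σ, hσ, hσC⟩ := extraction_of_frequently_atTop hC
    refine ⟨σ, hσ, fun k => V.starProjection (x (σ k)), max C 1,
      lt_max_of_lt_right one_pos, fun k => ?_, Or.inl fun k => hfix (σ k)⟩
    refine (Metric.infDist_le_dist_of_mem (hself _)).trans ?_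
    rw [dist_comm, dist_eq_norm]
    exact (hσC k).trans (mul_le_mul_of_nonneg_right (le_max_left _ _) (hε _).le)
  · push Not at hA
    have hratio : Tendsto (fun k => (ε k)⁻¹ * ‖w k‖) atTop atTop := by
      refine tendsto_atTop.2 fun C => ?_
      filter_upwards [hA C] with k hk
      rw [inv_mul_eq_div, le_div_iff₀ (hε k)]
      exact hk.le
    set u : ℕ → EucSp N := fun k => ‖w k‖⁻¹ • w k with hu
    have hwu : ∀ k, w k = ‖w k‖ • u k := by
      intro k
      by_cases h : w k = 0
      · simp [h]
      · simp only [hu]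
        rw [smul_inv_smul₀ (norm_ne_zero_iff.2 h)]
    have hun : ∀ k, w k ≠ 0 → ‖u k‖ = 1 := by
      intro k h
      simp only [hu, norm_smul, norm_inv, norm_norm]
      exact inv_mul_cancel₀ (norm_ne_zero_iff.2 h)
    have huball : ∀ k, u k ∈ Metric.closedBall (0 : EucSp N) 1 := by
      intro k
      rw [mem_closedBall_zero_iff]
      by_cases h : w k = 0
      · simp [hu, h]
      · exact (hun k h).le
    obtain ⟨u₀, -, σ, hσ, hlim⟩ := (isCompact_closedBall (0 : EucSp N) 1).tendsto_subseq huball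
    have hu₀norm : ‖u₀‖ = 1 := by
      refine tendsto_nhds_unique hlim.norm (tendsto_const_nhds.congr' ?_)
      have h0 := hσ.tendsto_atTop.eventually (hA 0)
      filter_upwards [h0] with k hk
      refine (hun (σ k) ?_).symm
      rw [zero_mul] at hk
      exact norm_pos_iff.1 hk
    have hu₀mem : u₀ ∈ Vᗮ :=
      V.isClosed_orthogonal.mem_of_tendsto hlim
        (Eventually.of_forall fun k => Vᗮ.smul_mem _ (hwmem _))
    have hinf : (orbitSet G u₀).Infinite := by
      refine (hS1 u₀).resolve_left fun h => ?_
      have hmem : u₀ ∈ V := by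
        intro g hg
        have : oact g u₀ ∈ orbitSet G u₀ := ⟨g, hg, rfl⟩
        rw [h] at this
        exact this
      have h0 : u₀ = 0 := by
        have := (Submodule.mem_orthogonal V u₀).1 hu₀mem u₀ hmem
        exact inner_self_eq_zero.1 this
      simp [h0] at hu₀norm
    refine ⟨σ, hσ, fun k => x (σ k), 1, one_pos, fun k => ?_, Or.inr fun m => ?_⟩
    · rw [Metric.infDist_zero_of_mem (hself _), one_mul]
      exact (hε _).le
    · haveI := hinf.to_subtype
      let e := Infinite.natEmbedding (orbitSet G u₀)
      choose f hfG hf using fun n => (e n).2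
      refine ⟨fun i => ⟨f i, hfG i⟩, fun i j hij => ?_⟩
      have hne : oact (f i) u₀ - oact (f j) u₀ ≠ 0 := by
        rw [hf, hf, sub_ne_zero]
        intro h
        exact hij (Fin.ext (e.injective (Subtype.ext h)))
      have hc : ∀ g : ONgrp N, Continuous (oact g) := fun g =>
        LinearMap.continuous_of_finiteDimensional
          (Matrix.toEuclideanLin (g : Matrix (Fin N) (Fin N) ℝ))
      have hl : Tendsto (fun k => ‖oact (f i) (u (σ k)) - oact (f j) (u (σ k))‖) atTop
          (𝓝 ‖oact (f i) u₀ - oact (f j) u₀‖) :=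
        ((((hc _).tendsto _).comp hlim).sub (((hc _).tendsto _).comp hlim)).norm
      have hr := (hratio.comp hσ.tendsto_atTop).atTop_mul_pos (norm_pos_iff.2 hne) hl
      refine hr.congr fun k => ?_
      have key : ∀ g ∈ G, oact g (x (σ k)) =
          V.starProjection (x (σ k)) + ‖w (σ k)‖ • oact g (u (σ k)) := by
        intro g hg
        have h1 : x (σ k) = V.starProjection (x (σ k)) + ‖w (σ k)‖ • u (σ k) := by
          rw [← hwu]; simp [hw]
        have h2 := hfix (σ k) g hg
        conv_lhs => rw [h1]
        unfold oact at h2 ⊢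
        rw [map_add, map_smul, h2]
      simp only [Function.comp]
      rw [key _ (hfG i), key _ (hfG j), add_sub_add_left_eq_sub, ← smul_sub, norm_smul,
        norm_norm, mul_assoc]
end
end

section
/- Let N = 4n + m with n ≥ 1 an integer and m ∈ {0,1,2,3}. Then for each j = 1, …, n there exist a closed subgroup G_j of O(N) and a continuous surjective homomorphism φ_j : G_j → {1,−1} with the following properties: (a) each pair (G_j, φ_j) satisfies (S1), (S2), (S3); (b) whenever 1 ≤ i < j ≤ n and u, v : ℝ^N → ℝ are functions which are not identically zero, u is φ_i-equivariant and v is φ_j-equivariant, then u ≠ v. -/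
noncomputable section

open Matrix

abbrev SymIx (n r : ℕ) : Type := (Fin 2 × Option (Fin n)) ⊕ Fin r

def rotM (c : ℂ) : Matrix (Fin 2) (Fin 2) ℝ := !![c.re, -c.im; c.im, c.re]

theorem rotM_mul (c d : ℂ) : rotM (c * d) = rotM c * rotM d := by
  ext i j
  fin_cases i <;> fin_cases j <;> simp [rotM, Matrix.mul_apply, Fin.sum_univ_two] <;> ring

theorem rotM_one : rotM 1 = 1 := by
  ext i j
  fin_cases i <;> fin_cases j <;> simp [rotM]

theorem rotM_conj (c : ℂ) : rotM (star c) = (rotM c)ᵀ := by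
  ext i j
  fin_cases i <;> fin_cases j <;> simp [rotM]

def torM {n r N : ℕ} (e : Fin N ≃ SymIx n r) (w : Option (Fin n) → Circle) :
    Matrix (Fin N) (Fin N) ℝ :=
  (fromBlocks (blockDiagonal fun k => rotM (w k : ℂ)) 0 0 1 :
    Matrix (SymIx n r) (SymIx n r) ℝ).submatrix e e

theorem torM_mul {n r N : ℕ} (e : Fin N ≃ SymIx n r) (w v : Option (Fin n) → Circle) :
    torM e (w * v) = torM e w * torM e v := by
  unfold torM
  rw [submatrix_mul_equiv, fromBlocks_multiply]
  simp [← blockDiagonal_mul, rotM_mul]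

theorem torM_one {n r N : ℕ} (e : Fin N ≃ SymIx n r) :
    torM e (1 : Option (Fin n) → Circle) = 1 := by
  unfold torM
  have : (blockDiagonal fun k : Option (Fin n) => rotM (((1 : Option (Fin n) → Circle) k : Circle) : ℂ)) = 1 := by
    simp only [Pi.one_apply, Circle.coe_one, rotM_one]
    exact blockDiagonal_one
  rw [this, fromBlocks_one, submatrix_one_equiv]

theorem torM_inv {n r N : ℕ} (e : Fin N ≃ SymIx n r) (w : Option (Fin n) → Circle) :
    torM e w⁻¹ = (torM e w)ᵀ := by
  unfold torM
  rw [transpose_submatrix, fromBlocks_transpose, blockDiagonal_transpose]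
  simp only [← rotM_conj, Pi.inv_apply, Circle.coe_inv_eq_conj, transpose_zero, transpose_one]
  rfl

def torHom {n r N : ℕ} (e : Fin N ≃ SymIx n r) : (Option (Fin n) → Circle) →* ONgrp N where
  toFun w := ⟨torM e w, by
    rw [mem_orthogonalGroup_iff]
    change torM e w * (torM e w)ᵀ = 1
    rw [← torM_inv, ← torM_mul, mul_inv_cancel, torM_one]⟩
  map_one' := Subtype.ext (torM_one e)
  map_mul' w v := Subtype.ext (torM_mul e w v)

theorem continuous_torHom {n r N : ℕ} (e : Fin N ≃ SymIx n r) : Continuous (torHom e) := by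
  refine Continuous.subtype_mk ?_ _
  unfold torM
  refine Continuous.matrix_submatrix ?_ _ _
  refine Continuous.matrix_fromBlocks ?_ continuous_const continuous_const continuous_const
  refine Continuous.matrix_blockDiagonal ?_
  refine continuous_pi fun k => ?_
  have h : Continuous fun w : Option (Fin n) → Circle => ((w k : Circle) : ℂ) :=
    continuous_subtype_val.comp (continuous_apply k)
  refine continuous_matrix fun i j => ?_
  fin_cases i <;> fin_cases j <;> simp only [rotM] <;> simp <;> fun_prop

/-- the `k`-th complex coordinate -/
def zc {n r N : ℕ} (e : Fin N ≃ SymIx n r) (x : EucSp N) (k : Option (Fin n)) : ℂ :=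
  ⟨x (e.symm (Sum.inl (0, k))), x (e.symm (Sum.inl (1, k)))⟩

theorem oact_apply' {N : ℕ} (g : ONgrp N) (x : EucSp N) (i : Fin N) :
    oact g x i = ∑ j, g.1 i j * x j := by
  simp [oact, Matrix.mulVec, dotProduct]

theorem oact_tor {n r N : ℕ} (e : Fin N ≃ SymIx n r) (w : Option (Fin n) → Circle)
    (x : EucSp N) (a : SymIx n r) :
    oact (torHom e w) x (e.symm a) = ∑ b, (fromBlocks (blockDiagonal fun k => rotM (w k : ℂ)) 0 0 1 :
    Matrix (SymIx n r) (SymIx n r) ℝ) a b * x (e.symm b) := by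
  rw [oact_apply', ← e.symm.sum_comp]
  simp [torHom, torM]

theorem zc_oact {n r N : ℕ} (e : Fin N ≃ SymIx n r) (w : Option (Fin n) → Circle)
    (x : EucSp N) (k : Option (Fin n)) :
    zc e (oact (torHom e w) x) k = w k * zc e x k := by
  apply Complex.ext <;> simp only [zc, oact_tor] <;>
  simp [Fintype.sum_sum_type, Fintype.sum_prod_type, blockDiagonal_apply, rotM, ite_mul] <;> ring

theorem oact_inr {n r N : ℕ} (e : Fin N ≃ SymIx n r) (w : Option (Fin n) → Circle)
    (x : EucSp N) (k : Fin r) :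
    oact (torHom e w) x (e.symm (Sum.inr k)) = x (e.symm (Sum.inr k)) := by
  rw [oact_tor]
  simp [Fintype.sum_sum_type, Matrix.one_apply]

theorem ext_zc {n r N : ℕ} (e : Fin N ≃ SymIx n r) {x y : EucSp N}
    (h : ∀ k, zc e x k = zc e y k)
    (h' : ∀ k, x (e.symm (Sum.inr k)) = y (e.symm (Sum.inr k))) : x = y := by
  ext i
  obtain ⟨a, rfl⟩ := e.symm.surjective i
  rcases a with ⟨b, k⟩ | k
  · have h1 := congrArg Complex.re (h k)
    have h2 := congrArg Complex.im (h k)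
    fin_cases b
    · exact h1
    · exact h2
  · exact h' k

def signK (n : ℕ) : Subgroup (Option (Fin n) → Circle) where
  carrier := {w | ∀ k, w k ^ 2 = w none ^ 2}
  one_mem' k := by simp
  mul_mem' {a b} ha hb k := by simp [mul_pow, ha k, hb k]
  inv_mem' {a} ha k := by simp [ha k]

theorem isClosed_signK (n : ℕ) : IsClosed (signK n : Set (Option (Fin n) → Circle)) := by
  have : (signK n : Set (Option (Fin n) → Circle)) = ⋂ k, {w | w k ^ 2 = w none ^ 2} := by
    ext w; simp [signK]
  rw [this]
  exact isClosed_iInter fun k => isClosed_eq (by fun_prop) (by fun_prop)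

def symG {n r N : ℕ} (e : Fin N ≃ SymIx n r) : Subgroup (ONgrp N) := (signK n).map (torHom e)

def xi0 {n r N : ℕ} (e : Fin N ≃ SymIx n r) : EucSp N :=
  WithLp.toLp 2 fun i => match e i with
    | Sum.inl (0, _) => 1
    | _ => 0

theorem zc_xi0 {n r N : ℕ} (e : Fin N ≃ SymIx n r) (k) : zc e (xi0 e) k = 1 := by
  apply Complex.ext <;> simp [zc, xi0]

def phi0 {n r N : ℕ} (e : Fin N ≃ SymIx n r) (k : Option (Fin n)) (g : ONgrp N) : ℝ :=
  (zc e (oact g (xi0 e)) k * star (zc e (oact g (xi0 e)) none)).re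

theorem phi0_tor {n r N : ℕ} (e : Fin N ≃ SymIx n r) (k : Option (Fin n)) (w) :
    phi0 e k (torHom e w) = ((w k : ℂ) * star (w none : ℂ)).re := by
  simp [phi0, zc_oact, zc_xi0]

theorem sign_cases {n : ℕ} {w : Option (Fin n) → Circle} (hw : w ∈ signK n) (k) :
    ((w k : ℂ) * star (w none : ℂ)) = 1 ∨ ((w k : ℂ) * star (w none : ℂ)) = -1 := by
  have h : w k ^ 2 = w none ^ 2 := hw k
  have h2 : (w k : ℂ) ^ 2 = (w none : ℂ) ^ 2 := by exact_mod_cast congrArg (fun c : Circle => (c : ℂ)) h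
  have h3 : (w none : ℂ) * star (w none : ℂ) = 1 := by
    have := Complex.mul_conj (w none : ℂ)
    simpa using this
  rcases sq_eq_sq_iff_eq_or_eq_neg.1 h2 with h | h
  · left; rw [h, h3]
  · right; rw [h, neg_mul, h3]

theorem phi0_mul {n r N : ℕ} (e : Fin N ≃ SymIx n r) (k : Option (Fin n)) {w v}
    (hw : w ∈ signK n) (hv : v ∈ signK n) :
    phi0 e k (torHom e w * torHom e v) = phi0 e k (torHom e w) * phi0 e k (torHom e v) := by
  rw [← map_mul, phi0_tor, phi0_tor, phi0_tor]
  have : (((w * v) k : Circle) : ℂ) * star (((w * v) none : Circle) : ℂ)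
    = ((w k : ℂ) * star (w none : ℂ)) * ((v k : ℂ) * star (v none : ℂ)) := by
    simp only [Pi.mul_apply, Circle.coe_mul, star_mul]
    ring
  rw [this]
  rcases sign_cases hw k with h | h <;> rcases sign_cases hv k with h' | h' <;>
    rw [h, h'] <;> simp

def symPhi {n r N : ℕ} (e : Fin N ≃ SymIx n r) (k : Option (Fin n)) : symG e →* ℝ where
  toFun g := phi0 e k g
  map_one' := by
    have := phi0_tor e k 1
    rw [map_one] at this
    simpa using this
  map_mul' := by
    rintro ⟨_, w, hw, rfl⟩ ⟨_, v, hv, rfl⟩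
    exact phi0_mul e k hw hv

theorem continuous_phi0 {n r N : ℕ} (e : Fin N ≃ SymIx n r) (k : Option (Fin n)) :
    Continuous (phi0 e k) := by
  have h : ∀ i, Continuous fun g : ONgrp N => oact g (xi0 e) i := by
    intro i
    simp only [oact_apply']
    refine continuous_finsetSum _ fun j _ => ?_
    exact ((continuous_subtype_val.matrix_elem i j)).mul continuous_const
  unfold phi0
  simp only [zc, Complex.mul_re, Complex.star_def, Complex.conj_re, Complex.conj_im]
  exact ((h _).mul (h _)).sub ((h _).mul (h _).neg)

def negOneCircle : Circle := Circle.exp Real.pi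

theorem coe_negOneCircle : (negOneCircle : ℂ) = -1 := by
  simp [negOneCircle, Circle.coe_exp]

def flipW {n : ℕ} (j : Fin n) : Option (Fin n) → Circle := Function.update 1 (some j) negOneCircle

theorem flipW_mem {n : ℕ} (j : Fin n) : flipW j ∈ signK n := by
  intro k
  apply Circle.ext
  by_cases h : k = some j
  · subst h; simp [flipW, coe_negOneCircle]
  · simp [flipW, h]

theorem phi0_flip_self {n r N : ℕ} (e : Fin N ≃ SymIx n r) (j : Fin n) :
    phi0 e (some j) (torHom e (flipW j)) = -1 := by
  rw [phi0_tor]; simp [flipW, coe_negOneCircle]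

theorem phi0_flip_ne {n r N : ℕ} (e : Fin N ≃ SymIx n r) {i j : Fin n} (h : i ≠ j) :
    phi0 e (some i) (torHom e (flipW j)) = 1 := by
  rw [phi0_tor]; simp [flipW, h]

theorem orbit_dich {n r N : ℕ} (e : Fin N ≃ SymIx n r) (x : EucSp N) :
    orbitSet (symG e) x = {x} ∨ (orbitSet (symG e) x).Infinite := by
  by_cases h : ∀ k, zc e x k = 0
  · left
    have key : ∀ w, oact (torHom e w) x = x := fun w =>
      ext_zc e (fun k => by rw [zc_oact, h k, mul_zero]) (oact_inr e w x)
    ext y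
    constructor
    · rintro ⟨_, ⟨w, hw, rfl⟩, rfl⟩
      exact key w
    · rintro rfl
      exact ⟨torHom e 1, ⟨1, (signK n).one_mem, rfl⟩, key 1⟩
  · right
    push Not at h
    obtain ⟨k, hk⟩ := h
    have hinf : Infinite Circle := by
      have : Infinite (Set.Ioc (-Real.pi) Real.pi) :=
        (Set.Ioc_infinite (by linarith [Real.pi_pos])).to_subtype
      refine Infinite.of_injective (fun s : Set.Ioc (-Real.pi) Real.pi => Circle.exp s) ?_
      intro s t hst
      exact Subtype.ext (Circle.exp_injOn_Ioc (by linarith) s.2 t.2 hst)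
    refine Set.infinite_of_injective_forall_mem
      (f := fun c : Circle => oact (torHom e fun _ => c) x) ?_ ?_
    · intro c d hcd
      have := congrArg (fun y => zc e y k) hcd
      simp only [zc_oact] at this
      exact Circle.ext (mul_right_cancel₀ hk this)
    · intro c
      exact ⟨_, ⟨fun _ => c, fun _ => rfl, rfl⟩, rfl⟩

/-- Let `N = 4n + m`, `n ≥ 1`, `m ∈ {0,1,2,3}`. For each `j = 1, …, n`
there are a closed subgroup `G_j` of `O(N)` and a continuous surjective homomorphism
`φ_j : G_j → {1,−1}` satisfying (S1)–(S3) and such that nontrivial `φ_i`- and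
`φ_j`-equivariant functions are distinct for `i < j`. -/
theorem exists_symmetries
    (n m N : ℕ) (hn : 1 ≤ n) (hm : m ≤ 3) (hN : N = 4 * n + m) :
    ∃ (G : Fin n → Subgroup (ONgrp N)) (φ : ∀ j : Fin n, (G j) →* ℝ),
      (∀ j : Fin n,
        IsClosed ((G j : Subgroup (ONgrp N)) : Set (ONgrp N)) ∧
        Continuous (φ j) ∧
        (∀ g : G j, φ j g = 1 ∨ φ j g = -1) ∧
        (∀ x : EucSp N, orbitSet (G j) x = {x} ∨ (orbitSet (G j) x).Infinite) ∧
        (∃ g : G j, φ j g = -1) ∧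
        (∃ ξ : EucSp N, ∀ g : G j, oact (g : ONgrp N) ξ = ξ → φ j g = 1)) ∧
      (∀ i j : Fin n, i < j → ∀ u v : EucSp N → ℝ, u ≠ 0 → v ≠ 0 →
        (∀ (g : G i) (x : EucSp N), u (oact (g : ONgrp N) x) = φ i g * u x) →
        (∀ (g : G j) (x : EucSp N), v (oact (g : ONgrp N) x) = φ j g * v x) →
        u ≠ v) := by
  have hcard : Fintype.card (Fin N) = Fintype.card (SymIx n (2 * n + m - 2)) := by
    simp; omega
  let e : Fin N ≃ SymIx n (2 * n + m - 2) := Fintype.equivOfCardEq hcard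
  have memG : ∀ j, torHom e (flipW j) ∈ symG e := fun j => ⟨flipW j, flipW_mem j, rfl⟩
  refine ⟨fun _ => symG e, fun j => symPhi e (some j), fun j => ⟨?_, ?_, ?_, ?_, ?_, ?_⟩, ?_⟩
  · exact ((isClosed_signK n).isCompact.image (continuous_torHom e)).isClosed
  · exact (continuous_phi0 e (some j)).comp continuous_subtype_val
  · rintro ⟨_, w, hw, rfl⟩
    change phi0 e (some j) (torHom e w) = 1 ∨ phi0 e (some j) (torHom e w) = -1
    rw [phi0_tor]
    rcases sign_cases hw (some j) with h | h <;> rw [h] <;> simp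
  · exact orbit_dich e
  · exact ⟨⟨_, memG j⟩, phi0_flip_self e j⟩
  · refine ⟨xi0 e, fun g hg => ?_⟩
    change phi0 e (some j) g = 1
    rw [phi0, hg, zc_xi0, zc_xi0]
    simp
  · rintro i j hij u v hu - h1 h2 rfl
    apply hu
    funext x
    have a := h1 ⟨_, memG j⟩ x
    have b := h2 ⟨_, memG j⟩ x
    have a' : symPhi e (some i) ⟨_, memG j⟩ = 1 := phi0_flip_ne e hij.ne
    have b' : symPhi e (some j) ⟨_, memG j⟩ = -1 := phi0_flip_self e j
    rw [a'] at a
    rw [b'] at b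
    rw [a] at b
    simp only [Pi.zero_apply]
    linarith
end
end

section
/- Principle of symmetric criticality for the critical p-Laplace functional: let G be a closed subgroup of O(N), φ : G → {1,−1} a continuous homomorphism, 1 < p < N, p* := Np/(N−p), and Θ a G-invariant nonempty open subset of ℝ^N. Let u : Θ → ℝ be a φ-equivariant function of class C¹ with ∫_Θ |∇u|^p < ∞ and ∫_Θ |u|^{p*} < ∞. If ∫_Θ ( |∇u|^{p−2}∇u·∇ϕ − |u|^{p*−2}uϕ ) = 0 for every smooth compactly supported φ-equivariant ϕ : Θ → ℝ, then ∫_Θ ( |∇u|^{p−2}∇u·∇ϑ − |u|^{p*−2}uϑ ) = 0 for every smooth compactly supported ϑ : Θ → ℝ; that is, u is a weak solution of −Δ_p u = |u|^{p*−2}u in Θ. -/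
open MeasureTheory
open scoped RealInnerProductSpace

noncomputable section

open Set Filter Topology

section GenericAverage

set_option linter.unusedSectionVars false

variable {X : Type} [TopologicalSpace X] [CompactSpace X] [SecondCountableTopology X]
  [MeasurableSpace X] [OpensMeasurableSpace X]

/-- The transported coefficient in the derivative of an average. -/
def avgCoeff {E F F' : Type} [NormedAddCommGroup E] [NormedSpace ℝ E]
    [NormedAddCommGroup F] [NormedSpace ℝ F] [NormedAddCommGroup F'] [NormedSpace ℝ F']
    (K : X → E →L[ℝ] E) (c : X → F →L[ℝ] F') (g : X) : (E →L[ℝ] F) →L[ℝ] (E →L[ℝ] F') :=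
  (ContinuousLinearMap.compL ℝ E F F' (c g)).comp
    ((ContinuousLinearMap.compL ℝ E E F).flip (K g))

lemma avgCoeff_apply {E F F' : Type} [NormedAddCommGroup E] [NormedSpace ℝ E]
    [NormedAddCommGroup F] [NormedSpace ℝ F] [NormedAddCommGroup F'] [NormedSpace ℝ F']
    (K : X → E →L[ℝ] E) (c : X → F →L[ℝ] F') (g : X) (A : E →L[ℝ] F) :
    avgCoeff K c g A = (c g).comp (A.comp (K g)) := rfl

lemma continuous_avgCoeff {E F F' : Type} [NormedAddCommGroup E] [NormedSpace ℝ E]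
    [NormedAddCommGroup F] [NormedSpace ℝ F] [NormedAddCommGroup F'] [NormedSpace ℝ F']
    {K : X → E →L[ℝ] E} (hK : Continuous K) {c : X → F →L[ℝ] F'} (hc : Continuous c) :
    Continuous (avgCoeff K c) := by
  unfold avgCoeff
  fun_prop

lemma continuous_avg {E F F' : Type} [NormedAddCommGroup E] [NormedSpace ℝ E] [ProperSpace E]
    [NormedAddCommGroup F] [NormedSpace ℝ F] [NormedAddCommGroup F'] [NormedSpace ℝ F']
    (μ : Measure X) [IsFiniteMeasure μ]
    {K : X → E →L[ℝ] E} (hK : Continuous K) {c : X → F →L[ℝ] F'} (hc : Continuous c)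
    {f : E → F} (hf : Continuous f) :
    Continuous (fun x => ∫ g, c g (f (K g x)) ∂μ) := by
  have hj : Continuous (fun q : E × X => c q.2 (f (K q.2 q.1))) := by fun_prop
  rw [continuous_iff_continuousAt]
  intro x₀
  obtain ⟨C, hC⟩ := ((isCompact_closedBall x₀ 1).prod (isCompact_univ (X := X))).exists_bound_of_continuousOn
    hj.continuousOn
  refine continuousAt_of_dominated (bound := fun _ => C) ?_ ?_ (integrable_const _) ?_
  · exact Eventually.of_forall fun x =>
      (hj.comp (by fun_prop : Continuous fun g : X => (x, g))).aestronglyMeasurable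
  · filter_upwards [Metric.closedBall_mem_nhds x₀ one_pos] with x hx
    exact Eventually.of_forall fun g => hC (x, g) ⟨hx, mem_univ _⟩
  · exact Eventually.of_forall fun g =>
      (hj.comp (by fun_prop : Continuous fun x : E => (x, g))).continuousAt

lemma hasFDerivAt_avg {E F F' : Type} [NormedAddCommGroup E] [NormedSpace ℝ E] [ProperSpace E]
    [NormedAddCommGroup F] [NormedSpace ℝ F] [NormedAddCommGroup F'] [NormedSpace ℝ F']
    (μ : Measure X) [IsFiniteMeasure μ]
    {K : X → E →L[ℝ] E} (hK : Continuous K) {c : X → F →L[ℝ] F'} (hc : Continuous c)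
    {f : E → F} (hf : ContDiff ℝ 1 f) (x₀ : E) :
    HasFDerivAt (fun x => ∫ g, c g (f (K g x)) ∂μ)
      (∫ g, avgCoeff K c g (fderiv ℝ f (K g x₀)) ∂μ) x₀ := by
  have hfc := hf.continuous
  have hf' : Continuous (fderiv ℝ f) := hf.continuous_fderiv one_ne_zero
  have hA := continuous_avgCoeff hK hc
  have hj : Continuous (fun q : E × X => c q.2 (f (K q.2 q.1))) := by fun_prop
  have hj' : Continuous (fun q : E × X => avgCoeff K c q.2 (fderiv ℝ f (K q.2 q.1))) := by
    fun_prop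
  obtain ⟨C, hC⟩ := ((isCompact_closedBall x₀ 1).prod (isCompact_univ (X := X))).exists_bound_of_continuousOn
    hj'.continuousOn
  obtain ⟨C₀, hC₀⟩ := ((isCompact_closedBall x₀ 1).prod (isCompact_univ (X := X))).exists_bound_of_continuousOn
    hj.continuousOn
  have hm : ∀ x : E, AEStronglyMeasurable (fun g => c g (f (K g x))) μ := fun x =>
    (hj.comp (by fun_prop : Continuous fun g : X => (x, g))).aestronglyMeasurable
  refine hasFDerivAt_integral_of_dominated_of_fderiv_le (𝕜 := ℝ)
    (F' := fun x g => avgCoeff K c g (fderiv ℝ f (K g x))) (bound := fun _ => C)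
    (Metric.closedBall_mem_nhds x₀ one_pos) ?_ ?_ ?_ ?_ (integrable_const _) ?_
  · exact Eventually.of_forall hm
  · exact Integrable.of_bound (hm x₀) C₀ (Eventually.of_forall fun g =>
      hC₀ (x₀, g) ⟨Metric.mem_closedBall_self zero_le_one, mem_univ _⟩)
  · exact (hj'.comp (by fun_prop : Continuous fun g : X => (x₀, g))).aestronglyMeasurable
  · exact Eventually.of_forall fun g x hx => hC (x, g) ⟨hx, mem_univ _⟩
  · refine Eventually.of_forall fun g x hx => ?_
    have h1 : HasFDerivAt f (fderiv ℝ f (K g x)) (K g x) :=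
      (hf.differentiable one_ne_zero _).hasFDerivAt
    exact (c g).hasFDerivAt.comp x (h1.comp x (K g).hasFDerivAt)

lemma contDiff_avg_nat {E : Type} [NormedAddCommGroup E] [NormedSpace ℝ E] [ProperSpace E]
    (μ : Measure X) [IsFiniteMeasure μ]
    {K : X → E →L[ℝ] E} (hK : Continuous K) (n : ℕ) :
    ∀ {F F' : Type} [NormedAddCommGroup F] [NormedSpace ℝ F]
      [NormedAddCommGroup F'] [NormedSpace ℝ F'] {c : X → F →L[ℝ] F'} (_ : Continuous c)
      {f : E → F} (_ : ContDiff ℝ n f),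
    ContDiff ℝ n (fun x => ∫ g, c g (f (K g x)) ∂μ) := by
  induction n with
  | zero =>
    intro F F' _ _ _ _ c hc f hf
    simp only [Nat.cast_zero, contDiff_zero] at hf ⊢
    exact continuous_avg μ hK hc hf
  | succ n ih =>
    intro F F' _ _ _ _ c hc f hf
    push_cast at hf ⊢
    have hf1 : ContDiff ℝ 1 f := hf.of_le (by simp)
    rw [contDiff_succ_iff_hasFDerivAt]
    refine ⟨fun x => ∫ g, avgCoeff K c g (fderiv ℝ f (K g x)) ∂μ, ?_,
      hasFDerivAt_avg μ hK hc hf1⟩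
    exact ih (continuous_avgCoeff hK hc) (hf.fderiv_right le_rfl)

end GenericAverage

instance compactSpace_ONgrp (N : ℕ) : CompactSpace (ONgrp N) := by
  refine isCompact_iff_compactSpace (s := ((Matrix.orthogonalGroup (Fin N) ℝ : Submonoid _) :
    Set (Matrix (Fin N) (Fin N) ℝ))).1 ?_
  have hsub : ((Matrix.orthogonalGroup (Fin N) ℝ : Submonoid _) : Set (Matrix (Fin N) (Fin N) ℝ)) ⊆
      Set.univ.pi fun _ => Set.univ.pi fun _ => Metric.closedBall (0:ℝ) 1 := by
    intro A hA i _ j _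
    simpa using entry_norm_bound_of_unitary (𝕜 := ℝ) hA i j
  refine IsCompact.of_isClosed_subset
    (isCompact_univ_pi fun _ => isCompact_univ_pi fun _ => isCompact_closedBall _ _) ?_ hsub
  exact isClosed_unitary

instance secondCountable_ONgrp (N : ℕ) : SecondCountableTopology (ONgrp N) := by
  haveI : SecondCountableTopology (Matrix (Fin N) (Fin N) ℝ) :=
    inferInstanceAs (SecondCountableTopology (Fin N → Fin N → ℝ))
  exact TopologicalSpace.Subtype.secondCountableTopology
    ((Matrix.orthogonalGroup (Fin N) ℝ : Submonoid _) : Set (Matrix (Fin N) (Fin N) ℝ))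

instance topGroup_ONgrp (N : ℕ) : IsTopologicalGroup (ONgrp N) :=
  inferInstanceAs (IsTopologicalGroup (unitary (Matrix (Fin N) (Fin N) ℝ)))

/-- The action of an orthogonal matrix as a continuous linear map. -/
def oactL {N : ℕ} (g : ONgrp N) : EucSp N →L[ℝ] EucSp N :=
  Matrix.toEuclideanCLM (n := Fin N) (𝕜 := ℝ) (g : Matrix (Fin N) (Fin N) ℝ)

lemma oactL_apply {N : ℕ} (g : ONgrp N) (x : EucSp N) : oactL g x = oact g x := rfl

lemma oact_mul {N : ℕ} (g h : ONgrp N) (x : EucSp N) : oact (g * h) x = oact g (oact h x) := by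
  simp only [← oactL_apply, oactL]
  simp

lemma oact_one {N : ℕ} (x : EucSp N) : oact (1 : ONgrp N) x = x := by
  simp only [← oactL_apply, oactL]
  simp

lemma oact_inv_oact {N : ℕ} (g : ONgrp N) (x : EucSp N) : oact g⁻¹ (oact g x) = x := by
  rw [← oact_mul]; simp [oact_one]

lemma oact_oact_inv {N : ℕ} (g : ONgrp N) (x : EucSp N) : oact g (oact g⁻¹ x) = x := by
  rw [← oact_mul]; simp [oact_one]

lemma norm_oact {N : ℕ} (g : ONgrp N) (x : EucSp N) : ‖oact g x‖ = ‖x‖ := by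
  have h : oactL g ∈ unitary (EucSp N →L[ℝ] EucSp N) := by
    unfold oactL
    exact Unitary.map_mem (Matrix.toEuclideanCLM (n := Fin N) (𝕜 := ℝ)) g.2
  exact (Unitary.linearIsometryEquiv ⟨oactL g, h⟩).norm_map x

lemma continuous_oactL (N : ℕ) : Continuous (oactL (N := N)) := by
  have : Continuous (Matrix.toEuclideanCLM (n := Fin N) (𝕜 := ℝ)) :=
    LinearMap.continuous_of_finiteDimensional
      ((Matrix.toEuclideanCLM (n := Fin N) (𝕜 := ℝ)).toAlgEquiv.toLinearMap)
  exact this.comp continuous_subtype_val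

/-- The action of an orthogonal matrix as a linear isometry equivalence. -/
def oactE {N : ℕ} (g : ONgrp N) : EucSp N ≃ₗᵢ[ℝ] EucSp N where
  toFun := oact g
  invFun := oact g⁻¹
  left_inv := oact_inv_oact g
  right_inv := oact_oact_inv g
  map_add' := map_add (oactL g)
  map_smul' := map_smul (oactL g)
  norm_map' := norm_oact g


lemma gradient_equiv {N : ℕ} {Θ : Set (EucSp N)} (hΘ : IsOpen Θ) {u : EucSp N → ℝ}
    (hu1 : ContDiffOn ℝ 1 u Θ) (g : ONgrp N) (s : ℝ)
    (hinv : ∀ x ∈ Θ, oact g⁻¹ x ∈ Θ)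
    (h : ∀ x ∈ Θ, u (oact g x) = s * u x) {x : EucSp N} (hx : x ∈ Θ) (hgx : oact g x ∈ Θ) :
    gradient u (oact g x) = s • oact g (gradient u x) := by
  have h1 : u =ᶠ[𝓝 (oact g x)] fun y => s * u (oactL g⁻¹ y) := by
    filter_upwards [hΘ.mem_nhds hgx] with y hy
    rw [oactL_apply, ← h _ (hinv y hy), oact_oact_inv]
  have hd : DifferentiableAt ℝ u x :=
    (hu1.differentiableOn one_ne_zero).differentiableAt (hΘ.mem_nhds hx)
  have h2 : HasFDerivAt (fun y => s * u (oactL g⁻¹ y))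
      (s • (fderiv ℝ u x).comp (oactL g⁻¹)) (oact g x) := by
    have h3 : HasFDerivAt u (fderiv ℝ u x) (oactL g⁻¹ (oact g x)) := by
      rw [oactL_apply, oact_inv_oact]; exact hd.hasFDerivAt
    exact (h3.comp (oact g x) (oactL g⁻¹).hasFDerivAt).const_mul s
  have h4 : fderiv ℝ u (oact g x) = s • (fderiv ℝ u x).comp (oactL g⁻¹) :=
    (h2.congr_of_eventuallyEq h1).fderiv
  refine ext_inner_right ℝ fun v => ?_
  rw [inner_gradient_left, h4, inner_smul_left]
  have h5 : ⟪oact g (gradient u x), v⟫ = ⟪gradient u x, oact g⁻¹ v⟫ := by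
    have := (oactE g).inner_map_map (gradient u x) (oact g⁻¹ v)
    rw [← this]
    change _ = ⟪oact g (gradient u x), oact g (oact g⁻¹ v)⟫
    rw [oact_oact_inv]
  rw [h5, inner_gradient_left]
  simp [oactL_apply]

lemma integral_comp_inv {N : ℕ} (p q : ℝ) {Θ : Set (EucSp N)} (hΘ : IsOpen Θ) {u : EucSp N → ℝ}
    (hu1 : ContDiffOn ℝ 1 u Θ) (g : ONgrp N) (s : ℝ) (hs : s = 1 ∨ s = -1)
    (hinv : ∀ x ∈ Θ, oact g⁻¹ x ∈ Θ) (hinv' : ∀ x ∈ Θ, oact g x ∈ Θ)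
    (h : ∀ x ∈ Θ, u (oact g x) = s * u x)
    {ϑ : EucSp N → ℝ} (hϑ : ContDiff ℝ 1 ϑ) :
    ∫ x in Θ, ((fderiv ℝ ϑ (oact g⁻¹ x)) (oact g⁻¹ (‖gradient u x‖ ^ (p - 2) • gradient u x))
        - |u x| ^ (q - 2) * u x * ϑ (oact g⁻¹ x))
    = s * ∫ x in Θ, (‖gradient u x‖ ^ (p - 2) * ⟪gradient u x, gradient ϑ x⟫
        - |u x| ^ (q - 2) * u x * ϑ x) := by
  have hmp : MeasurePreserving (oact g) (volume : Measure (EucSp N)) volume :=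
    (oactE g).measurePreserving
  have hemb : MeasurableEmbedding (oact g) :=
    (oactE g).toHomeomorph.measurableEmbedding
  have hpre : Set.preimage (oact g) Θ = Θ := by
    ext x
    constructor
    · intro hx
      have := hinv _ hx
      rwa [oact_inv_oact] at this
    · exact hinv' x
  have := hmp.setIntegral_preimage_emb hemb (fun x => ((fderiv ℝ ϑ (oact g⁻¹ x)) (oact g⁻¹ (‖gradient u x‖ ^ (p - 2) • gradient u x))
        - |u x| ^ (q - 2) * u x * ϑ (oact g⁻¹ x))) Θ
  rw [← this, hpre, ← integral_const_mul]
  refine setIntegral_congr_fun hΘ.measurableSet fun x hx => ?_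
  have habs : |s| = 1 := by rcases hs with rfl | rfl <;> simp
  have hg := gradient_equiv hΘ hu1 g s hinv h hx (hinv' x hx)
  have hn : ‖gradient u (oact g x)‖ = ‖gradient u x‖ := by
    rw [hg, norm_smul, norm_oact, Real.norm_eq_abs, habs, one_mul]
  have hu : |u (oact g x)| = |u x| := by rw [h x hx, abs_mul, habs, one_mul]
  simp only [hn, hu]
  rw [hg, h x hx, oact_inv_oact]
  have e1 : oact g⁻¹ (‖gradient u x‖ ^ (p - 2) • s • oact g (gradient u x))
      = ‖gradient u x‖ ^ (p - 2) • s • gradient u x := by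
    rw [← oactL_apply, map_smul, map_smul, oactL_apply, oact_inv_oact]
  rw [e1, real_inner_comm, inner_gradient_left, map_smul, map_smul]
  simp only [smul_eq_mul]
  ring

lemma norm_rpow_smul {E : Type} [NormedAddCommGroup E] [NormedSpace ℝ E] {p : ℝ} (hp : 1 < p)
    (v : E) : ‖‖v‖ ^ (p - 2) • v‖ = ‖v‖ ^ (p - 1) := by
  rcases eq_or_ne v 0 with rfl | hv
  · simp [Real.zero_rpow (by linarith : p - 1 ≠ 0)]
  · have : 0 < ‖v‖ := norm_pos_iff.2 hv
    rw [norm_smul, Real.norm_of_nonneg (by positivity)]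
    nth_rewrite 2 [← Real.rpow_one ‖v‖]
    rw [← Real.rpow_add this]
    congr 1; ring

lemma integrableOn_rpow_smul {N : ℕ} {E : Type} [NormedAddCommGroup E] [NormedSpace ℝ E]
    {K : Set (EucSp N)} (hK : IsCompact K) {p : ℝ} (hp : 1 < p) {f : EucSp N → E}
    (hf : ContinuousOn f K) : IntegrableOn (fun x => ‖f x‖ ^ (p - 2) • f x) K := by
  have hm : AEStronglyMeasurable f (volume.restrict K) :=
    hf.aestronglyMeasurable_of_isCompact hK hK.measurableSet
  have hc : ContinuousOn (fun x => ‖f x‖ ^ (p - 1)) K :=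
    hf.norm.rpow_const fun x _ => Or.inr (by linarith)
  have hi : IntegrableOn (fun x => ‖f x‖ ^ (p - 1)) K := hc.integrableOn_compact hK
  refine Integrable.mono' hi ?_ ?_
  · exact ((hm.norm.aemeasurable.pow_const (p - 2)).aestronglyMeasurable).smul hm
  · exact Eventually.of_forall fun x => (norm_rpow_smul hp (f x)).le

/-- principle of symmetric criticality for the critical `p`-Laplace
functional. If a `φ`-equivariant `C¹` function `u` on a `G`-invariant open set `Θ`
satisfies `∫_Θ (|∇u|^{p−2}∇u·∇ϕ − |u|^{p*−2}uϕ) = 0` for every smooth compactly supported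
`φ`-equivariant test function `ϕ`, then the same holds for every smooth compactly
supported test function `ϑ`, i.e. `u` is a weak solution of `−Δ_p u = |u|^{p*−2}u` in `Θ`. -/
theorem symmetric_criticality
    (N : ℕ) (G : Subgroup (ONgrp N)) (hGclosed : IsClosed (G : Set (ONgrp N)))
    (φ : G →* ℝ) (hφcont : Continuous φ) (hφval : ∀ g : G, φ g = 1 ∨ φ g = -1)
    (p : ℝ) (hp1 : 1 < p) (hpN : p < (N : ℝ))
    (Θ : Set (EucSp N)) (hΘopen : IsOpen Θ) (hΘne : Θ.Nonempty)
    (hΘinv : ∀ g ∈ G, ∀ x ∈ Θ, oact g x ∈ Θ)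
    (u : EucSp N → ℝ) (hu1 : ContDiffOn ℝ 1 u Θ)
    (huInt : IntegrableOn (fun x => ‖gradient u x‖ ^ p) Θ)
    (huInt' : IntegrableOn (fun x => |u x| ^ pStar N p) Θ)
    (huEqv : ∀ (g : G), ∀ x ∈ Θ, u (oact (g : ONgrp N) x) = φ g * u x)
    (hcrit : ∀ ϕ : EucSp N → ℝ, ContDiff ℝ (⊤ : ℕ∞) ϕ → HasCompactSupport ϕ → tsupport ϕ ⊆ Θ →
      (∀ (g : G) (x : EucSp N), ϕ (oact (g : ONgrp N) x) = φ g * ϕ x) →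
      (∫ x in Θ, (‖gradient u x‖ ^ (p - 2) * ⟪gradient u x, gradient ϕ x⟫
        - |u x| ^ (pStar N p - 2) * u x * ϕ x)) = 0) :
    ∀ ϑ : EucSp N → ℝ, ContDiff ℝ (⊤ : ℕ∞) ϑ → HasCompactSupport ϑ → tsupport ϑ ⊆ Θ →
      (∫ x in Θ, (‖gradient u x‖ ^ (p - 2) * ⟪gradient u x, gradient ϑ x⟫
        - |u x| ^ (pStar N p - 2) * u x * ϑ x)) = 0 := by
  intro ϑ hϑ hϑc hϑΘ
  set q := pStar N p with hq
  have hq1 : 1 < q := by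
    have h0 : 0 < (N : ℝ) - p := by linarith
    rw [hq, pStar, lt_div_iff₀ h0]
    nlinarith
  have hϑ1 : ContDiff ℝ 1 ϑ := hϑ.of_le (by exact_mod_cast le_top)
  have hϑcont : Continuous ϑ := hϑ1.continuous
  have hϑ' : Continuous (fderiv ℝ ϑ) := hϑ1.continuous_fderiv one_ne_zero
  haveI : CompactSpace G := isCompact_iff_compactSpace.1 hGclosed.isCompact
  letI : MeasurableSpace G := borel G
  haveI : BorelSpace G := ⟨rfl⟩
  haveI : SecondCountableTopology G :=
    TopologicalSpace.Subtype.secondCountableTopology (G : Set (ONgrp N))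
  let K₀ : TopologicalSpace.PositiveCompacts G := ⊤
  let μ : Measure G := Measure.haarMeasure K₀
  haveI : IsProbabilityMeasure μ := ⟨by
    have := Measure.haarMeasure_self (K₀ := K₀)
    simpa [K₀] using this⟩
  let A : G → EucSp N →L[ℝ] EucSp N := fun g => oactL ((g : ONgrp N)⁻¹)
  have hA : Continuous A := (continuous_oactL N).comp (continuous_subtype_val.inv)
  let c : G → ℝ →L[ℝ] ℝ := fun g => φ g • ContinuousLinearMap.id ℝ ℝ
  have hc : Continuous c := hφcont.smul continuous_const
  let Φ : EucSp N → ℝ := fun x => ∫ g, c g (ϑ (A g x)) ∂μ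
  have hΦs : ContDiff ℝ (⊤ : ℕ∞) Φ := by
    rw [contDiff_infty]
    exact fun n => contDiff_avg_nat μ hA n hc (hϑ.of_le (by exact_mod_cast le_top))
  -- the compact set carrying the average
  let K : Set (EucSp N) := Set.image (fun q : G × EucSp N => oactL (q.1 : ONgrp N) q.2)
    (univ ×ˢ tsupport ϑ)
  have hcontL : Continuous (fun q : G × EucSp N => oactL (q.1 : ONgrp N) q.2) := by
    have : Continuous (fun g : G => oactL (g : ONgrp N)) :=
      (continuous_oactL N).comp continuous_subtype_val
    exact (this.comp continuous_fst).clm_apply continuous_snd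
  have hKc : IsCompact K := (isCompact_univ.prod hϑc).image hcontL
  have hKΘ : K ⊆ Θ := by
    rintro _ ⟨⟨g, x⟩, ⟨-, hx⟩, rfl⟩
    exact hΘinv g g.2 x (hϑΘ hx)
  have hnot : ∀ x ∉ K, ∀ g : G, A g x ∉ tsupport ϑ := by
    intro x hx g hg
    exact hx ⟨(g, A g x), ⟨mem_univ _, hg⟩, oact_oact_inv (g : ONgrp N) x⟩
  have hz : ∀ x ∉ K, ∀ g : G, ϑ (A g x) = 0 := fun x hx g =>
    image_eq_zero_of_notMem_tsupport (hnot x hx g)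
  have hz' : ∀ x ∉ K, ∀ g : G, fderiv ℝ ϑ (A g x) = 0 := fun x hx g =>
    fderiv_of_notMem_tsupport ℝ (hnot x hx g)
  have hΦz : ∀ x ∉ K, Φ x = 0 := by
    intro x hx
    simp [Φ, hz x hx]
  have hΦc : HasCompactSupport Φ := HasCompactSupport.intro hKc hΦz
  have hΦK : tsupport Φ ⊆ K := closure_minimal
    (fun x hx => by by_contra h; exact hx (hΦz x h)) hKc.isClosed
  have hφsq : ∀ g : G, φ g * φ g = 1 := by
    intro g; rcases hφval g with h | h <;> simp [h]
  have hΦe : ∀ (g : G) (x : EucSp N), Φ (oact (g : ONgrp N) x) = φ g * Φ x := by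
    intro h x
    have e := integral_mul_left_eq_self (μ := μ)
      (fun g : G => c g (ϑ (A g (oact (h : ONgrp N) x)))) h
    change ∫ g, c g (ϑ (A g (oact (h : ONgrp N) x))) ∂μ = φ h * ∫ g, c g (ϑ (A g x)) ∂μ
    rw [← e, ← integral_const_mul]
    refine integral_congr_ae (Eventually.of_forall fun g => ?_)
    have e2 : A (h * g) (oact (h : ONgrp N) x) = A g x := by
      simp only [A, oactL_apply, ← oact_mul]
      congr 1
      simp
    simp only [e2]
    simp [c, mul_assoc]
  have hmain := hcrit Φ hΦs hΦc (hΦK.trans hKΘ) hΦe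
  -- the vector field and the zero order term, cut off outside `K`
  let V : EucSp N → EucSp N := fun x => ‖gradient u x‖ ^ (p - 2) • gradient u x
  let W : EucSp N → ℝ := fun x => |u x| ^ (q - 2) * u x
  have hgradc : ContinuousOn (gradient u) K := by
    have h1 : ContinuousOn (fderiv ℝ u) Θ := hu1.continuousOn_fderiv_of_isOpen hΘopen le_rfl
    exact ((InnerProductSpace.toDual ℝ (EucSp N)).symm.continuous.comp_continuousOn h1).mono hKΘ
  have hV : IntegrableOn V K := integrableOn_rpow_smul hKc hp1 hgradc
  have hW : IntegrableOn W K :=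
    integrableOn_rpow_smul hKc hq1 (hu1.continuousOn.mono hKΘ)
  have hVK : Integrable (K.indicator V) (volume.restrict Θ) :=
    (hV.integrable_indicator hKc.measurableSet).restrict
  have hWK : Integrable (K.indicator W) (volume.restrict Θ) :=
    (hW.integrable_indicator hKc.measurableSet).restrict
  let H : EucSp N → G → ℝ := fun x g =>
    φ g * (fderiv ℝ ϑ (A g x) (A g (V x)) - W x * ϑ (A g x))
  have hHeq : ∀ x g, H x g = φ g * ((fderiv ℝ ϑ (A g x)).comp (A g) (K.indicator V x)
      - K.indicator W x * ϑ (A g x)) := by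
    intro x g
    by_cases hx : x ∈ K
    · simp [H, hx]
    · simp [H, hx, hz x hx, hz' x hx]
  obtain ⟨C₁, hC₁⟩ := hϑc.exists_bound_of_continuous hϑcont
  obtain ⟨C₂, hC₂⟩ := (hϑc.fderiv (𝕜 := ℝ)).exists_bound_of_continuous hϑ'
  have hHint : Integrable (Function.uncurry H) ((volume.restrict Θ).prod μ) := by
    have hb : Integrable (fun z : EucSp N × G => C₂ * ‖K.indicator V z.1‖
        + C₁ * ‖K.indicator W z.1‖) ((volume.restrict Θ).prod μ) :=
      ((hVK.norm.const_mul C₂).add (hWK.norm.const_mul C₁)).comp_fst μ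
    refine hb.mono' ?_ ?_
    · have hVm : AEStronglyMeasurable (fun z : EucSp N × G => K.indicator V z.1)
          ((volume.restrict Θ).prod μ) := (hVK.comp_fst μ).aestronglyMeasurable
      have hWm : AEStronglyMeasurable (fun z : EucSp N × G => K.indicator W z.1)
          ((volume.restrict Θ).prod μ) := (hWK.comp_fst μ).aestronglyMeasurable
      have hD : Continuous (fun z : EucSp N × G => (fderiv ℝ ϑ (A z.2 z.1)).comp (A z.2)) := by
        fun_prop
      have hT : Continuous (fun z : EucSp N × G => ϑ (A z.2 z.1)) := by fun_prop
      have hP : Continuous (fun z : EucSp N × G => φ z.2) := by fun_prop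
      have h1 := (ContinuousLinearMap.id ℝ (EucSp N →L[ℝ] ℝ)).aestronglyMeasurable_comp₂
        hD.aestronglyMeasurable hVm
      have h2 := hP.aestronglyMeasurable.mul (h1.sub (hWm.mul hT.aestronglyMeasurable))
      refine h2.congr (Eventually.of_forall fun z => ?_)
      exact (hHeq z.1 z.2).symm
    · refine Eventually.of_forall fun z => ?_
      obtain ⟨x, g⟩ := z
      change ‖H x g‖ ≤ C₂ * ‖K.indicator V x‖ + C₁ * ‖K.indicator W x‖
      have hab : ‖φ g‖ = 1 := by rcases hφval g with h | h <;> simp [h]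
      rw [hHeq, norm_mul, hab, one_mul]
      refine (norm_sub_le _ _).trans (add_le_add ?_ ?_)
      · rw [ContinuousLinearMap.comp_apply]
        refine (ContinuousLinearMap.le_opNorm _ _).trans ?_
        have : ‖A g (K.indicator V x)‖ = ‖K.indicator V x‖ := norm_oact _ _
        rw [this]
        exact mul_le_mul_of_nonneg_right (hC₂ _) (norm_nonneg _)
      · rw [norm_mul, mul_comm]
        exact mul_le_mul_of_nonneg_right (hC₁ _) (norm_nonneg _)
  have hpt : ∀ x, ‖gradient u x‖ ^ (p - 2) * ⟪gradient u x, gradient Φ x⟫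
        - |u x| ^ (q - 2) * u x * Φ x = ∫ g, H x g ∂μ := by
    intro x
    have hcD : Continuous (fun g : G => avgCoeff A c g (fderiv ℝ ϑ (A g x))) := by
      have := continuous_avgCoeff hA hc
      fun_prop
    have hcDV : Continuous (fun g : G => avgCoeff A c g (fderiv ℝ ϑ (A g x)) (V x)) := by
      fun_prop
    have hcT : Continuous (fun g : G => W x * c g (ϑ (A g x))) := by fun_prop
    have hint : ∀ {F : Type} [NormedAddCommGroup F] {f : G → F}, Continuous f →
        Integrable f μ := fun hf =>
      hf.integrable_of_hasCompactSupport (HasCompactSupport.of_compactSpace _)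
    have hfd : fderiv ℝ Φ x = ∫ g, avgCoeff A c g (fderiv ℝ ϑ (A g x)) ∂μ :=
      (hasFDerivAt_avg μ hA hc hϑ1 x).fderiv
    have e1 : ‖gradient u x‖ ^ (p - 2) * ⟪gradient u x, gradient Φ x⟫ = fderiv ℝ Φ x (V x) := by
      rw [real_inner_comm, inner_gradient_left]
      simp [V]
    rw [e1, hfd, ContinuousLinearMap.integral_apply (hint hcD)]
    change _ - W x * ∫ g, c g (ϑ (A g x)) ∂μ = _
    rw [← integral_const_mul, ← integral_sub (hint hcDV) (hint hcT)]
    refine integral_congr_ae (Eventually.of_forall fun g => ?_)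
    simp only [avgCoeff_apply, H, c]
    simp
    ring
  simp only [hpt] at hmain
  rw [integral_integral_swap hHint] at hmain
  rw [← hmain]
  have hconst : ∀ g : G, ∫ x in Θ, H x g = ∫ x in Θ, (‖gradient u x‖ ^ (p - 2)
      * ⟪gradient u x, gradient ϑ x⟫ - |u x| ^ (q - 2) * u x * ϑ x) := by
    intro g
    have := integral_comp_inv p q hΘopen hu1 (g : ONgrp N) (φ g) (hφval g)
      (fun x hx => hΘinv _ (G.inv_mem g.2) x hx) (fun x hx => hΘinv _ g.2 x hx)
      (fun x hx => huEqv g x hx) hϑ1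
    simp only [H]
    rw [integral_const_mul]
    change φ g * (∫ x in Θ, ((fderiv ℝ ϑ (oact (g : ONgrp N)⁻¹ x))
      (oact (g : ONgrp N)⁻¹ (‖gradient u x‖ ^ (p - 2) • gradient u x))
        - |u x| ^ (q - 2) * u x * ϑ (oact (g : ONgrp N)⁻¹ x))) = _
    rw [this, ← mul_assoc, hφsq, one_mul]
  simp only [hconst]
  simp
end
end

section
/- Let N = 4n + m with n ≥ 1 an integer and m ∈ {0,1,2,3}, and identify ℝ^N ≅ (ℂ²)^j × ℝ^{N−4j} for 1 ≤ j ≤ n. Let Γ be the subgroup of linear isometries of ℂ² generated by the maps (ζ_1, ζ_2) ↦ (e^{iθ}ζ_1, e^{iθ}ζ_2) for θ ∈ [0, 2π) and ϱ(ζ_1, ζ_2) := (−conj(ζ_2), conj(ζ_1)), and let φ : Γ → {1,−1} be the homomorphism determined by φ(e^{iθ}) = 1 and φ(ϱ) = −1. For each j, let G_j := Γ^j × Λ_j act coordinatewise on (ℂ²)^j × ℝ^{N−4j}, where Λ_j := O(N−4j) for j < n and Λ_n is the trivial group, and define φ_j : G_j → {1,−1} by φ_j(γ_1, …, γ_j,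 η) := φ(γ_1)⋯φ(γ_j). Then: if 1 ≤ i < j ≤ n and u, v : ℝ^N → ℝ are functions which are not identically zero, u is φ_i-equivariant and v is φ_j-equivariant, then u ≠ v. -/
noncomputable section

/-- The domain `ℝ^N ≅ (ℂ²)^n × ℝ^m` (with `N = 4n + m`), identified compatibly with the
identifications `ℝ^N ≅ (ℂ²)^j × ℝ^{N−4j}` for every `1 ≤ j ≤ n`. -/
abbrev Dom (n m : ℕ) : Type := (Fin n → ℂ × ℂ) × (Fin m → ℝ)

/-- Multiplication of the `t`-th `ℂ²`-coordinate by `e^{iθ}`, i.e. the generator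
`(ζ₁, ζ₂) ↦ (e^{iθ}ζ₁, e^{iθ}ζ₂)` of `Γ` acting in the `t`-th block. -/
def rotAt {n m : ℕ} (t : Fin n) (θ : ℝ) (x : Dom n m) : Dom n m :=
  (Function.update x.1 t
    (Complex.exp (θ * Complex.I) * (x.1 t).1, Complex.exp (θ * Complex.I) * (x.1 t).2),
   x.2)

/-- The generator `ϱ(ζ₁, ζ₂) = (−conj ζ₂, conj ζ₁)` of `Γ` acting in the `t`-th
`ℂ²`-coordinate. -/
def rhoAt {n m : ℕ} (t : Fin n) (x : Dom n m) : Dom n m :=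
  (Function.update x.1 t (-(starRingEnd ℂ) ((x.1 t).2), (starRingEnd ℂ) ((x.1 t).1)),
   x.2)

/-- `τ` is an element of `{1} × O(N−4j)`:  a real-linear bijection of
`ℝ^N ≅ (ℂ²)^n × ℝ^m` preserving the Euclidean norm, fixing the first `j`
`ℂ²`-coordinates, and acting on the last `N − 4j` real coordinates (i.e. the value of the
tail coordinates of `τ x` depends only on the tail coordinates of `x`). -/
def IsTailIso {n m : ℕ} (j : ℕ) (τ : Dom n m → Dom n m) : Prop :=
  IsLinearMap ℝ τ ∧ Function.Bijective τ ∧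
  (∀ x : Dom n m,
      (∑ t, (‖((τ x).1 t).1‖ ^ 2 + ‖((τ x).1 t).2‖ ^ 2)) + ∑ s, ((τ x).2 s) ^ 2
        = (∑ t, (‖(x.1 t).1‖ ^ 2 + ‖(x.1 t).2‖ ^ 2)) + ∑ s, (x.2 s) ^ 2) ∧
  (∀ (x : Dom n m) (t : Fin n), (t : ℕ) < j → (τ x).1 t = x.1 t) ∧
  (∀ x y : Dom n m, (∀ t : Fin n, j ≤ (t : ℕ) → x.1 t = y.1 t) → x.2 = y.2 →
      (∀ t : Fin n, j ≤ (t : ℕ) → (τ x).1 t = (τ y).1 t) ∧ (τ x).2 = (τ y).2)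

/-- `u` is `φ_j`-equivariant for the group `G_j = Γ^j × Λ_j` acting coordinatewise on
`(ℂ²)^j × ℝ^{N−4j}` with `φ_j(γ₁, …, γ_j, η) = φ(γ₁)⋯φ(γ_j)`:  since `Γ` is generated by
the rotations `e^{iθ}` (with `φ = 1`) and `ϱ` (with `φ = −1`), and `Λ_j = O(N−4j)` for
`j < n` while `Λ_n` is trivial, this says:  `u` is invariant under the rotations in the
first `j` blocks, anti-invariant under `ϱ` in the first `j` blocks, and (when `j < n`)
invariant under `Λ_j = O(N−4j)`. -/
def EquivariantAt (n m : ℕ) (j : ℕ) (u : Dom n m → ℝ) : Prop :=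
  (∀ t : Fin n, (t : ℕ) < j → ∀ (θ : ℝ) (x : Dom n m), u (rotAt t θ x) = u x) ∧
  (∀ t : Fin n, (t : ℕ) < j → ∀ x : Dom n m, u (rhoAt t x) = - u x) ∧
  (j < n → ∀ τ : Dom n m → Dom n m, IsTailIso j τ → ∀ x : Dom n m, u (τ x) = u x)

theorem rhoAt_four {n m : ℕ} (t : Fin n) (x : Dom n m) :
    rhoAt t (rhoAt t (rhoAt t (rhoAt t x))) = x := by
  simp [rhoAt]

theorem rhoAt_isTailIso {n m : ℕ} (i : ℕ) (t : Fin n) (ht : i ≤ (t : ℕ)) :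
    IsTailIso i (rhoAt (m := m) t) := by
  refine ⟨⟨?_, ?_⟩, ⟨?_, ?_⟩, ?_, ?_, ?_⟩
  · intro x y
    refine Prod.ext ?_ rfl
    funext s
    by_cases h : s = t
    · subst h
      simp [rhoAt]
      ring
    · simp [rhoAt, h]
  · intro c x
    refine Prod.ext ?_ rfl
    funext s
    by_cases h : s = t
    · subst h
      simp [rhoAt]
    · simp [rhoAt, h]
  · intro x y h
    rw [← rhoAt_four t x, h, rhoAt_four]
  · intro y
    exact ⟨_, rhoAt_four t y⟩
  · intro x
    congr 1
    refine Finset.sum_congr rfl fun s _ => ?_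
    by_cases h : s = t
    · subst h
      simp [rhoAt]
      ring
    · simp [rhoAt, h]
  · intro x s hs
    have h : s ≠ t := by
      rintro rfl
      omega
    simp [rhoAt, h]
  · intro x y h h2
    refine ⟨fun s hs => ?_, h2⟩
    by_cases hst : s = t
    · subst hst
      simp [rhoAt, h s hs]
    · simp [rhoAt, hst, h s hs]

/-- With the groups `G_j = Γ^j × Λ_j` and homomorphisms `φ_j`
constructed above, nontrivial `φ_i`- and `φ_j`-equivariant functions with `i < j` are
distinct. -/
theorem equivariant_functions_distinct
    (n m N : ℕ) (hn : 1 ≤ n) (hm : m ≤ 3) (hN : N = 4 * n + m)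
    (i j : ℕ) (hi : 1 ≤ i) (hij : i < j) (hjn : j ≤ n)
    (u v : Dom n m → ℝ) (hu : u ≠ 0) (hv : v ≠ 0)
    (hueqv : EquivariantAt n m i u) (hveqv : EquivariantAt n m j v) :
    u ≠ v := by
  rintro rfl
  apply hu
  funext x
  have hin : i < n := lt_of_lt_of_le hij hjn
  have h1 := hueqv.2.2 hin _ (rhoAt_isTailIso i ⟨i, hin⟩ le_rfl) x
  have h2 := hveqv.2.1 ⟨i, hin⟩ hij x
  simp only [Pi.zero_apply]
  linarith
end
end
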